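/- arXiv:2009.12866 — 4 statements merged into one kernel-verified Lean document; each statement's English description precedes it below -/
import Mathlib

section
/- Let X, Y, Z be Banach spaces and let λ₀ > 0. Let λ ↦ A_λ be a family of bounded linear operators from X to Y, defined for λ ∈ ℝ, depending continuously on λ with respect to the operator norm, and such that each A_λ is injective. Let λ ↦ K_λ be a family of bounded linear operators from X to Z, depending continuously on λ with respect to the operator norm, and such that each K_λ is a compact operator. Suppose there exists a constant C > 0 such that for every λ with |λ| ≤ λ₀ and every u ∈ X one has ‖u‖_X ≤ C(‖A_λ u‖_Y + ‖K_λ u‖_Z). Then there exists a constant C' > 0 such that for every λ with |λ| ≤ λ₀ and every u ∈ X one has ‖u‖_X ≤ C' ‖A_λ u‖_Y. -/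
open Filter Topology in
/-- An injective bounded operator which is bounded below modulo a compact operator is bounded
below. -/
theorem exists_norm_le_of_norm_le_add_isCompactOperator {X Y Z : Type*}
    [NormedAddCommGroup X] [NormedSpace ℝ X] [CompleteSpace X]
    [NormedAddCommGroup Y] [NormedSpace ℝ Y]
    [NormedAddCommGroup Z] [NormedSpace ℝ Z]
    {T : X →L[ℝ] Y} (hT : Function.Injective T) {S : X →L[ℝ] Z} (hS : IsCompactOperator S)
    {C : ℝ} (hC : 0 ≤ C) (h : ∀ u, ‖u‖ ≤ C * (‖T u‖ + ‖S u‖)) :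
    ∃ c > 0, ∀ u, ‖u‖ ≤ c * ‖T u‖ := by
  by_contra! hcon
  have hunit : ∀ n : ℕ, ∃ v : X, ‖v‖ = 1 ∧ ‖T v‖ ≤ 1 / ((n : ℝ) + 1) := by
    intro n
    have hn : (0 : ℝ) < n + 1 := by positivity
    obtain ⟨u, hu⟩ := hcon (n + 1) hn
    have hu0 : 0 < ‖u‖ := lt_of_le_of_lt (by positivity) hu
    refine ⟨‖u‖⁻¹ • u, norm_smul_inv_norm (𝕜 := ℝ) (norm_pos_iff.1 hu0), ?_⟩
    rw [map_smul, norm_smul, norm_inv, norm_norm, inv_mul_eq_div, div_le_div_iff₀ hu0 hn]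
    linarith
  choose v hv1 hTv using hunit
  have hTv0 : Tendsto (fun n => T (v n)) atTop (𝓝 0) :=
    squeeze_zero_norm hTv tendsto_one_div_add_atTop_nhds_zero_nat
  obtain ⟨M, hM, hSM⟩ := IsCompactOperator.image_closedBall_subset_compact
    (f := (S : X →ₗ[ℝ] Z)) hS 1
  obtain ⟨z, -, φ, hφ, hz⟩ := hM.tendsto_subseq (x := fun n => S (v n))
    fun n => hSM ⟨v n, by simp [hv1], rfl⟩
  have hanti : AntilipschitzWith (2 * C).toNNReal (T.prod S) := by
    refine ContinuousLinearMap.antilipschitz_of_bound _ fun u => (h u).trans ?_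
    rw [Real.coe_toNNReal _ (by positivity), mul_comm 2 C, mul_assoc]
    gcongr
    linarith [norm_fst_le (T.prod S u), norm_snd_le (T.prod S u),
      show ‖(T.prod S u).1‖ = ‖T u‖ from rfl, show ‖(T.prod S u).2‖ = ‖S u‖ from rfl]
  have hemb := hanti.isClosedEmbedding (T.prod S).uniformContinuous
  have hlim : Tendsto (fun n => T.prod S (v (φ n))) atTop (𝓝 (0, z)) :=
    (hTv0.comp hφ.tendsto_atTop).prodMk_nhds hz
  obtain ⟨w, hw⟩ := hemb.isClosed_range.mem_of_tendsto hlim (.of_forall fun n => ⟨_, rfl⟩)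
  rw [← hw] at hlim
  have hvw : Tendsto (fun n => v (φ n)) atTop (𝓝 w) := hemb.isInducing.tendsto_nhds_iff.2 hlim
  have hw0 : w = 0 := hT ((congrArg Prod.fst hw).trans (map_zero T).symm)
  have hnorm := hvw.norm
  simp only [hv1, hw0, norm_zero] at hnorm
  exact one_ne_zero (tendsto_nhds_unique tendsto_const_nhds hnorm)

open Topology in
/-- A lower bound for one member of a continuous family of operators persists nearby, with twice
the constant. -/
theorem eventually_norm_le_of_continuousAt {L X Y : Type*} [TopologicalSpace L]
    [NormedAddCommGroup X] [NormedSpace ℝ X] [NormedAddCommGroup Y] [NormedSpace ℝ Y]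
    {A : L → X →L[ℝ] Y} {l : L} (hA : ContinuousAt A l) {c : ℝ} (hc : 0 < c)
    (h : ∀ u, ‖u‖ ≤ c * ‖A l u‖) :
    ∀ᶠ m in 𝓝 l, ∀ u, ‖u‖ ≤ 2 * c * ‖A m u‖ := by
  filter_upwards [Metric.continuousAt_iff'.1 hA (2 * c)⁻¹ (by positivity)] with m hm u
  have hdiff : ‖A l u - A m u‖ ≤ (2 * c)⁻¹ * ‖u‖ := by
    rw [dist_comm, dist_eq_norm] at hm
    exact (A l - A m).le_of_opNorm_le hm.le u
  have htri : ‖A l u‖ ≤ ‖A m u‖ + (2 * c)⁻¹ * ‖u‖ := by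
    linarith [norm_sub_norm_le (A l u) (A m u)]
  have hmul : c * ‖A l u‖ ≤ c * ‖A m u‖ + ‖u‖ / 2 := by
    calc c * ‖A l u‖ ≤ c * (‖A m u‖ + (2 * c)⁻¹ * ‖u‖) := by gcongr
      _ = c * ‖A m u‖ + ‖u‖ / 2 := by field_simp
  linarith [h u]

/-- Lemma 2.6 (abstract estimate): if a continuous family of injective bounded operators
`A l : X → Y` satisfies, uniformly for `|l| ≤ l₀`, the estimate
`‖u‖ ≤ C (‖A l u‖ + ‖K l u‖)` with `K l : X → Z` a continuous family of compact operators,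
then `‖u‖ ≤ C' ‖A l u‖` uniformly for `|l| ≤ l₀`. -/
theorem stmt0 {X Y Z : Type*}
    [NormedAddCommGroup X] [NormedSpace ℝ X] [CompleteSpace X]
    [NormedAddCommGroup Y] [NormedSpace ℝ Y] [CompleteSpace Y]
    [NormedAddCommGroup Z] [NormedSpace ℝ Z] [CompleteSpace Z]
    (l₀ : ℝ) (hl₀ : 0 < l₀)
    (A : ℝ → X →L[ℝ] Y) (hAcont : Continuous A)
    (hAinj : ∀ l : ℝ, Function.Injective (A l))
    (K : ℝ → X →L[ℝ] Z) (hKcont : Continuous K)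
    (hKcpt : ∀ l : ℝ, IsCompactOperator (K l))
    (C : ℝ) (hC : 0 < C)
    (hest : ∀ l : ℝ, |l| ≤ l₀ → ∀ u : X, ‖u‖ ≤ C * (‖A l u‖ + ‖K l u‖)) :
    ∃ C' > 0, ∀ l : ℝ, |l| ≤ l₀ → ∀ u : X, ‖u‖ ≤ C' * ‖A l u‖ := by
  have hcompact : IsCompact {l : ℝ | |l| ≤ l₀} := by
    simpa [Metric.closedBall, Real.dist_eq] using isCompact_closedBall (0 : ℝ) l₀
  refine hcompact.induction_on
    (p := fun s => ∃ C' > 0, ∀ l ∈ s, ∀ u : X, ‖u‖ ≤ C' * ‖A l u‖)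
    ⟨1, one_pos, by simp⟩ ?_ ?_ ?_
  · rintro s t hst ⟨c, hc, h⟩
    exact ⟨c, hc, fun l hl => h l (hst hl)⟩
  · rintro s t ⟨c, hc, hs⟩ ⟨d, hd, ht⟩
    refine ⟨max c d, lt_max_of_lt_left hc, fun l hl u => ?_⟩
    rcases hl with hl | hl
    · exact (hs l hl u).trans (by gcongr; exact le_max_left c d)
    · exact (ht l hl u).trans (by gcongr; exact le_max_right c d)
  · intro l hl
    obtain ⟨c, hc, h⟩ := exists_norm_le_of_norm_le_add_isCompactOperator (hAinj l) (hKcpt l)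
      hC.le (hest l hl)
    exact ⟨_, mem_nhdsWithin_of_mem_nhds
      (eventually_norm_le_of_continuousAt hAcont.continuousAt hc h),
      2 * c, by positivity, fun m hm => hm⟩
end

section
/- Let m > 1/2, β ∈ (0, m − 1/2), C > 0 and M > 0. There exists a constant C' > 0, depending only on m, β, C and M, such that the following holds: for every ε with 0 < ε < 1 and every sequence a : ℤ → ℂ satisfying (i) ∑_{k ∈ ℤ} (1 + k²)^m |a(k)|² ≤ M², and (ii) |a(−k)| ≤ C ε k for every integer k ≥ 1, one has ∑_{k=1}^∞ (1 + k²)^β |a(−k)|² ≤ C' ε^{(m − 1/2 − β)/(m + 1)}. -/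
theorem Real.le_rpow_mul_rpow_of_le_of_le {x A B θ : ℝ} (hx : 0 ≤ x) (hA : x ≤ A) (hB : x ≤ B)
    (h0 : 0 ≤ θ) (h1 : θ ≤ 1) : x ≤ A ^ θ * B ^ (1 - θ) := by
  calc x = x ^ θ * x ^ (1 - θ) := by
        rw [← Real.rpow_add_of_nonneg hx h0 (by linarith)]; simp
    _ ≤ A ^ θ * B ^ (1 - θ) := by
        have := sub_nonneg.2 h1
        gcongr
        exact Real.rpow_nonneg (hx.trans hA) _

theorem summable_one_add_sq_rpow_neg {p : ℝ} (hp : 1 / 2 < p) :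
    Summable (fun k : ℕ => (1 + ((k : ℝ) + 1) ^ 2) ^ (-p)) := by
  have h : Summable (fun k : ℕ => (((k + 1 : ℕ) : ℝ)) ^ (-(2 * p))) :=
    (summable_nat_add_iff 1).2 (Real.summable_nat_rpow.2 (by linarith))
  refine h.of_nonneg_of_le (fun k => by positivity) fun k => ?_
  have hk : (0 : ℝ) < (k : ℝ) + 1 := by positivity
  calc (1 + ((k : ℝ) + 1) ^ 2) ^ (-p) ≤ (((k : ℝ) + 1) ^ 2) ^ (-p) :=
        Real.rpow_le_rpow_of_nonpos (by positivity) (by linarith) (by linarith)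
    _ = ((k + 1 : ℕ) : ℝ) ^ (-(2 * p)) := by
        rw [← Real.rpow_natCast, ← Real.rpow_mul hk.le]
        push_cast
        ring_nf

/-- Interpolation between `b² ≤ C² ε² w` and `w ^ m b² ≤ M²` with exponents `γ / 2`
and `1 - γ / 2`. -/
theorem rpow_mul_sq_le_of_interpolation {m β γ C M ε w b : ℝ} (hγ0 : 0 ≤ γ) (hγ2 : γ ≤ 2)
    (hC : 0 ≤ C) (hε : 0 ≤ ε) (hw : 0 < w)
    (hlow : b ^ 2 ≤ C ^ 2 * ε ^ 2 * w) (hhigh : w ^ m * b ^ 2 ≤ M ^ 2) :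
    w ^ β * b ^ 2 ≤ C ^ γ * (M ^ 2) ^ (1 - γ / 2) * ε ^ γ *
      w ^ (-(m - β - γ * (m + 1) / 2)) := by
  have hB : b ^ 2 ≤ M ^ 2 * w ^ (-m) := by
    rw [Real.rpow_neg hw.le, ← div_eq_mul_inv, le_div_iff₀ (by positivity), mul_comm]
    exact hhigh
  have hsq : ∀ x : ℝ, 0 ≤ x → (x ^ 2) ^ (γ / 2) = x ^ γ := fun x hx => by
    rw [← Real.rpow_natCast, ← Real.rpow_mul hx]
    congr 1
    push_cast
    ring
  have key := Real.le_rpow_mul_rpow_of_le_of_le (sq_nonneg b) hlow hB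
    (by linarith : 0 ≤ γ / 2) (by linarith)
  rw [Real.mul_rpow (by positivity) hw.le, Real.mul_rpow (by positivity) (by positivity),
    hsq C hC, hsq ε hε, Real.mul_rpow (by positivity) (by positivity), ← Real.rpow_mul hw.le]
    at key
  have hexp : -(m - β - γ * (m + 1) / 2) = β + γ / 2 + -m * (1 - γ / 2) := by ring
  rw [hexp, Real.rpow_add hw, Real.rpow_add hw]
  calc _ ≤ w ^ β * _ := mul_le_mul_of_nonneg_left key (by positivity)
    _ = _ := by ring


/-- Quantitative holomorphic-extension lemma, stated in terms of Fourier coefficients: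
if `a : ℤ → ℂ` satisfies `∑ (1+k²)^m |a k|² ≤ M²` and `|a (-k)| ≤ C ε k` for `k ≥ 1`,
then the `H^β`-norm (squared) of the anti-holomorphic part is `≲ ε^((m-1/2-β)/(m+1))`. -/
theorem stmt1 (m β C M : ℝ) (hm : 1/2 < m) (hβ : β ∈ Set.Ioo 0 (m - 1/2))
    (hC : 0 < C) (hM : 0 < M) :
    ∃ C' > 0, ∀ ε : ℝ, 0 < ε → ε < 1 → ∀ a : ℤ → ℂ,
      Summable (fun k : ℤ => (1 + (k : ℝ)^2) ^ m * ‖a k‖^2) →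
      (∑' k : ℤ, (1 + (k : ℝ)^2) ^ m * ‖a k‖^2) ≤ M^2 →
      (∀ k : ℕ, 1 ≤ k → ‖a (-(k : ℤ))‖ ≤ C * ε * k) →
      (∑' k : ℕ, (1 + ((k : ℝ) + 1)^2) ^ β * ‖a (-((k : ℤ) + 1))‖^2)
        ≤ C' * ε ^ ((m - 1/2 - β) / (m + 1)) := by
  obtain ⟨hβ0, hβm⟩ := hβ
  have hm1 : 0 < m + 1 := by linarith
  set γ := (m - 1/2 - β) / (m + 1) with hγ
  have hγm : γ * (m + 1) = m - 1/2 - β := div_mul_cancel₀ _ hm1.ne'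
  have hγ0 : 0 ≤ γ := div_nonneg (by linarith) hm1.le
  have hγ2 : γ ≤ 2 := (div_le_iff₀ hm1).2 (by linarith)
  set p := m - β - γ * (m + 1) / 2 with hp
  have hS := summable_one_add_sq_rpow_neg (p := p) (by rw [hp, hγm]; linarith)
  set S := ∑' k : ℕ, (1 + ((k : ℝ) + 1) ^ 2) ^ (-p)
  have hSpos : 0 < S := hS.tsum_pos (fun k => by positivity) 0 (by positivity)
  refine ⟨C ^ γ * (M ^ 2) ^ (1 - γ / 2) * S, by positivity, fun ε hε _ a hsum hle hlow => ?_⟩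
  have hterm : ∀ k : ℕ, (1 + ((k : ℝ) + 1)^2) ^ β * ‖a (-((k : ℤ) + 1))‖^2 ≤
      C ^ γ * (M ^ 2) ^ (1 - γ / 2) * ε ^ γ * (1 + ((k : ℝ) + 1)^2) ^ (-p) := fun k => by
    refine rpow_mul_sq_le_of_interpolation hγ0 hγ2 hC.le hε.le (by positivity) ?_ ?_
    · have h := hlow (k + 1) (by omega)
      push_cast at h
      calc _ ≤ (C * ε * ((k : ℝ) + 1)) ^ 2 := by gcongr
        _ = C ^ 2 * ε ^ 2 * ((k : ℝ) + 1) ^ 2 := by ring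
        _ ≤ _ := by gcongr; linarith
    · have h := (hsum.le_tsum (-((k : ℤ) + 1)) fun j _ => by positivity).trans hle
      push_cast at h
      rwa [neg_sq] at h
  have hmaj := hS.mul_left (C ^ γ * (M ^ 2) ^ (1 - γ / 2) * ε ^ γ)
  calc _ ≤ ∑' k : ℕ, C ^ γ * (M ^ 2) ^ (1 - γ / 2) * ε ^ γ * (1 + ((k : ℝ) + 1)^2) ^ (-p) :=
        (hmaj.of_nonneg_of_le (fun k => by positivity) hterm).tsum_le_tsum hterm hmaj
    _ = _ := by rw [tsum_mul_left]; ring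
end

section
/- Let G : ℂ → ℂ be continuously differentiable (as a function of two real variables) with compact support. Define u : ℂ → ℂ by u(z) = (1/π) ∫_ℂ G(w)/(z − w) dA(w). Then u is real-differentiable at every point of ℂ and satisfies the ∂̄-equation ∂u/∂z̄ = G on ℂ; that is, (1/2)(∂u/∂x + i ∂u/∂y)(z) = G(z) for every z = x + iy ∈ ℂ. -/
open MeasureTheory

/-- The Cauchy kernel is locally integrable on the plane. -/
theorem Complex.locallyIntegrable_inv : LocallyIntegrable (fun w : ℂ => w⁻¹) := by
  refine locallyIntegrable_of_norm_le_rpow (C := 1) (α := 1) (by simp) (by simp) ?_ ?_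
  · refine Filter.Eventually.of_forall fun w => ?_
    simp [Real.rpow_neg_one]
  · exact measurable_inv.aestronglyMeasurable

/-- A continuous function vanishing for `R < p.1` is integrable on the domain of polar
coordinates. -/
theorem Continuous.integrableOn_polarCoord_target {f : ℝ × ℝ → ℂ} (hf : Continuous f) {R : ℝ}
    (hR : ∀ p : ℝ × ℝ, R < p.1 → f p = 0) :
    IntegrableOn f (Set.Ioi (0 : ℝ) ×ˢ Set.Ioo (-Real.pi) Real.pi) (volume.prod volume) := by
  have hK : IntegrableOn f (Set.Icc (0 : ℝ) R ×ˢ Set.Icc (-Real.pi) Real.pi)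
      (volume.prod volume) :=
    hf.continuousOn.integrableOn_compact (isCompact_Icc.prod isCompact_Icc)
  refine hK.of_forall_sdiff_eq_zero (measurableSet_Ioi.prod measurableSet_Ioo) ?_
  rintro p ⟨⟨hp1, hp2⟩, hp⟩
  refine hR p (lt_of_not_ge fun h => hp ⟨⟨le_of_lt hp1, h⟩, Set.Ioo_subset_Icc_self hp2⟩)

/-- The Wirtinger derivative in polar coordinates. -/
theorem ContinuousLinearMap.polar_wirtinger (L : ℂ →L[ℝ] ℂ) {r : ℝ} (hr : 0 < r) (θ : ℝ) :
    r • ((r * Complex.exp (θ * Complex.I))⁻¹ * (L 1 + Complex.I * L Complex.I)) =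
      L (Complex.exp (θ * Complex.I)) +
        Complex.I * L (Complex.exp (θ * Complex.I) * Complex.I) := by
  have hL : ∀ a b : ℝ, L (a + b * Complex.I) = a * L 1 + b * L Complex.I := by
    intro a b
    have : (a + b * Complex.I : ℂ) = a • (1 : ℂ) + b • Complex.I := by simp
    rw [this, map_add, map_smul, map_smul]
    simp
  have h1 : Complex.exp (θ * Complex.I) = (Real.cos θ : ℂ) + (Real.sin θ : ℂ) * Complex.I := by
    rw [Complex.exp_mul_I]; push_cast; rfl
  have h2 : Complex.exp (θ * Complex.I) * Complex.I =
      ((-Real.sin θ : ℝ) : ℂ) + (Real.cos θ : ℂ) * Complex.I := by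
    rw [h1]; push_cast; linear_combination (Complex.sin θ) * Complex.I_sq
  have h3 : (Complex.exp (θ * Complex.I))⁻¹ =
      (Real.cos θ : ℂ) - (Real.sin θ : ℂ) * Complex.I := by
    rw [← Complex.exp_neg, ← neg_mul, Complex.exp_mul_I, Complex.cos_neg, Complex.sin_neg]
    push_cast; ring
  have hr' : (r : ℂ) ≠ 0 := by exact_mod_cast hr.ne'
  rw [h2, hL, h1, hL, ← h1, mul_inv, h3, Complex.real_smul]
  push_cast
  field_simp
  linear_combination (-Complex.sin θ * L Complex.I) * Complex.I_sq

/-- The Cauchy–Pompeiu formula at the origin, for compactly supported functions. -/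
theorem integral_inv_mul_wirtinger (H : ℂ → ℂ) (hH : ContDiff ℝ 1 H)
    (hs : HasCompactSupport H) :
    ∫ w : ℂ, w⁻¹ * (fderiv ℝ H w 1 + Complex.I * fderiv ℝ H w Complex.I) =
      -(2 * Real.pi * H 0) := by
  obtain ⟨R, hR⟩ := hs.isCompact.isBounded.subset_closedBall 0
  have hzero : ∀ w : ℂ, R < ‖w‖ → w ∉ tsupport H := fun w hw h => by
    have := hR h
    rw [mem_closedBall_zero_iff] at this
    exact absurd this hw.not_ge
  have hcont : Continuous (fderiv ℝ H) := hH.continuous_fderiv one_ne_zero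
  have hd : ∀ w, HasFDerivAt H (fderiv ℝ H w) w := fun w =>
    (hH.differentiable one_ne_zero w).hasFDerivAt
  have hnorm : ∀ r θ : ℝ, ‖(r * Complex.exp (θ * Complex.I) : ℂ)‖ = |r| := fun r θ => by
    simp [Complex.norm_exp_ofReal_mul_I]
  have hfd : ∀ r θ : ℝ, R < r → fderiv ℝ H (r * Complex.exp (θ * Complex.I)) = 0 :=
    fun r θ hr => by
      have h : R < ‖(r * Complex.exp (θ * Complex.I) : ℂ)‖ := by
        rw [hnorm]; exact hr.trans_le (le_abs_self r)
      exact image_eq_zero_of_notMem_tsupport fun h' => hzero _ h (tsupport_fderiv_subset ℝ h')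
  set A : ℝ × ℝ → ℂ := fun p =>
    fderiv ℝ H (p.1 * Complex.exp (p.2 * Complex.I)) (Complex.exp (p.2 * Complex.I)) with hA
  set B : ℝ × ℝ → ℂ := fun p =>
    fderiv ℝ H (p.1 * Complex.exp (p.2 * Complex.I))
      (Complex.exp (p.2 * Complex.I) * Complex.I) with hB
  have hAc : Continuous A := (hcont.comp (by fun_prop)).clm_apply (by fun_prop)
  have hBc : Continuous B := (hcont.comp (by fun_prop)).clm_apply (by fun_prop)
  have hAi := hAc.integrableOn_polarCoord_target (R := R) fun p hp => by
    simp [hA, hfd p.1 p.2 hp]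
  have hBi := hBc.integrableOn_polarCoord_target (R := R) fun p hp => by
    simp [hB, hfd p.1 p.2 hp]
  have hAint : ∀ θ : ℝ, ∫ r in Set.Ioi (0 : ℝ), A (r, θ) = -H 0 := fun θ => by
    have hderiv : ∀ r : ℝ, HasDerivAt (fun r : ℝ => H (r * Complex.exp (θ * Complex.I)))
        (A (r, θ)) r := fun r => by
      have h1 : HasDerivAt (fun r : ℝ => (r * Complex.exp (θ * Complex.I) : ℂ))
          (Complex.exp (θ * Complex.I)) r := by
        simpa using (Complex.ofRealCLM.hasDerivAt (x := r)).mul_const (Complex.exp (θ * Complex.I))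
      exact (hd _).comp_hasDerivAt r h1
    have hint : IntegrableOn (fun r => A (r, θ)) (Set.Ioi (0 : ℝ)) := by
      have hK : IntegrableOn (fun r => A (r, θ)) (Set.Icc (0 : ℝ) R) :=
        (hAc.comp (by fun_prop : Continuous fun r : ℝ => (r, θ))).continuousOn.integrableOn_compact
          isCompact_Icc
      refine hK.of_forall_sdiff_eq_zero measurableSet_Ioi ?_
      rintro r ⟨hr0, hr⟩
      have : R < r := lt_of_not_ge fun h => hr ⟨le_of_lt hr0, h⟩
      simp [hA, hfd r θ this]
    have hlim : Filter.Tendsto (fun r : ℝ => H (r * Complex.exp (θ * Complex.I)))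
        Filter.atTop (nhds 0) := by
      refine tendsto_const_nhds.congr' ?_
      filter_upwards [Filter.eventually_gt_atTop R] with r hr
      refine (image_eq_zero_of_notMem_tsupport (hzero _ ?_)).symm
      rw [hnorm]; exact hr.trans_le (le_abs_self r)
    rw [integral_Ioi_of_hasDerivAt_of_tendsto' (fun r _ => hderiv r) hint hlim]
    simp
  have hBint : ∀ r ∈ Set.Ioi (0 : ℝ), ∫ θ in Set.Ioo (-Real.pi) Real.pi, B (r, θ) = 0 := by
    intro r hr
    have hr' : (r : ℂ) ≠ 0 := by exact_mod_cast (ne_of_gt hr)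
    have hderiv : ∀ θ : ℝ, HasDerivAt (fun θ : ℝ => H (r * Complex.exp (θ * Complex.I)))
        (r • B (r, θ)) θ := fun θ => by
      have h1 : HasDerivAt (fun θ : ℝ => (r * Complex.exp (θ * Complex.I) : ℂ))
          (r • (Complex.exp (θ * Complex.I) * Complex.I)) θ := by
        have h0 : (fun θ : ℝ => (r * Complex.exp (θ * Complex.I) : ℂ)) = circleMap 0 r := by
          funext θ; simp [circleMap]
        rw [h0]
        simpa [circleMap, mul_assoc] using hasDerivAt_circleMap 0 r θ
      have := (hd _).comp_hasDerivAt θ h1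
      rwa [map_smul] at this
    have hBr : Continuous fun θ : ℝ => r • B (r, θ) :=
      (hBc.comp (by fun_prop : Continuous fun θ : ℝ => (r, θ))).const_smul r
    have h := intervalIntegral.integral_eq_sub_of_hasDerivAt (a := -Real.pi) (b := Real.pi)
      (fun θ _ => hderiv θ) (hBr.intervalIntegrable _ _)
    have hends : Complex.exp (((-Real.pi : ℝ) : ℂ) * Complex.I) =
        Complex.exp ((Real.pi : ℂ) * Complex.I) := by
      rw [Complex.exp_pi_mul_I]
      push_cast
      rw [neg_mul, Complex.exp_neg, Complex.exp_pi_mul_I]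
      norm_num
    rw [hends, sub_self, intervalIntegral.integral_smul,
      intervalIntegral.integral_of_le (by linarith [Real.pi_pos]),
      integral_Ioc_eq_integral_Ioo] at h
    exact (smul_eq_zero.mp h).resolve_left (ne_of_gt hr)
  rw [← Complex.integral_comp_polarCoord_symm, polarCoord_target,
    setIntegral_congr_fun (g := fun p => A p + Complex.I * B p)
      (measurableSet_Ioi.prod measurableSet_Ioo), Measure.volume_eq_prod,
    integral_add hAi (hBi.const_mul _), integral_const_mul, setIntegral_prod _ hBi,
    setIntegral_congr_fun measurableSet_Ioi hBint]
  · rw [IntegrableOn, ← Measure.prod_restrict] at hAi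
    rw [← Measure.prod_restrict, integral_prod_symm _ hAi]
    simp only [hAint]
    simp [Real.pi_pos.le, ← two_mul]
  · rintro p ⟨hp, -⟩
    have := (fderiv ℝ H (p.1 * Complex.exp (p.2 * Complex.I))).polar_wirtinger hp p.2
    simp only [Complex.polarCoord_symm_apply, hA, hB]
    rw [← this, Complex.exp_mul_I]
    push_cast
    rfl

/-- If `G : ℂ → ℂ` is `C¹` with compact support and
`u z = (1/π) ∫ G w / (z - w) dA(w)`, then `u` is real-differentiable everywhere and
solves the `∂̄`-equation `(1/2)(∂ₓu + i ∂_y u) = G`. -/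
theorem stmt5 (G : ℂ → ℂ) (hG : ContDiff ℝ 1 G) (hsupp : HasCompactSupport G)
    (u : ℂ → ℂ) (hu : ∀ z : ℂ, u z = (Real.pi : ℂ)⁻¹ * ∫ w : ℂ, G w / (z - w)) :
    ∀ z : ℂ, DifferentiableAt ℝ u z ∧
      (1/2 : ℂ) * (fderiv ℝ u z 1 + Complex.I * fderiv ℝ u z Complex.I) = G z := by
  intro z
  let M : ℂ →L[ℝ] ℂ →L[ℝ] ℂ := ContinuousLinearMap.mul ℝ ℂ
  let k : ℂ → ℂ := fun w => w⁻¹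
  have hk : LocallyIntegrable k := Complex.locallyIntegrable_inv
  have hu' : u = fun x => (Real.pi : ℂ)⁻¹ * convolution k G M volume x := by
    funext x
    rw [hu, convolution_def, ← integral_sub_left_eq_self _ _ x]
    congr 2 with w
    simp [M, k, div_eq_mul_inv, mul_comm]
  have hGc : Continuous (fderiv ℝ G) := hG.continuous_fderiv one_ne_zero
  have hfd : HasFDerivAt u ((Real.pi : ℂ)⁻¹ •
      convolution k (fderiv ℝ G) (M.precompR ℂ) volume z) z := by
    rw [hu']
    exact (hsupp.hasFDerivAt_convolution_right M hk hG z).const_mul _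
  have hv : ∀ v, fderiv ℝ u z v = (Real.pi : ℂ)⁻¹ * ∫ w, w⁻¹ * fderiv ℝ G (z - w) v := fun v => by
    rw [hfd.fderiv, smul_apply,
      convolution_precompR_apply M hk (hsupp.fderiv ℝ) hGc]
    rfl
  have hint : ∀ v, Integrable fun w => w⁻¹ * fderiv ℝ G (z - w) v := fun v =>
    (HasCompactSupport.convolutionExists_right M
      ((hsupp.fderiv ℝ).comp_left (g := fun L : ℂ →L[ℝ] ℂ => L v) rfl) hk
      (hGc.clm_apply continuous_const) z)
  let H : ℂ → ℂ := fun w => G (z - w)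
  have hHd : ∀ w v, fderiv ℝ H w v = -fderiv ℝ G (z - w) v := fun w v => by
    have h := (hG.differentiable one_ne_zero (z - w)).hasFDerivAt.comp w
      ((hasFDerivAt_id (𝕜 := ℝ) w).const_sub z)
    rw [show H = G ∘ HSub.hSub z from rfl, h.fderiv]
    simp
  have hH := integral_inv_mul_wirtinger H (hG.comp (contDiff_const.sub contDiff_id))
    (hsupp.comp_homeomorph (Homeomorph.subLeft z))
  refine ⟨hfd.differentiableAt, ?_⟩
  have hsum : (∫ w, w⁻¹ * fderiv ℝ G (z - w) 1) +
      Complex.I * ∫ w, w⁻¹ * fderiv ℝ G (z - w) Complex.I = 2 * Real.pi * G z := by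
    rw [← integral_const_mul, ← integral_add (hint _) ((hint _).const_mul _)]
    rw [← neg_inj, ← integral_neg]
    simp only [hHd, H, sub_zero] at hH
    rw [← hH]
    congr 1 with w
    ring
  have hpi : (Real.pi : ℂ) ≠ 0 := by exact_mod_cast Real.pi_ne_zero
  rw [hv, hv, mul_left_comm Complex.I, ← mul_add, hsum]
  field_simp
end

section
/- Let H be a complex Hilbert space and σ ∈ (0, 1]. There exists a constant C > 0, depending only on σ, such that the following holds: for all K > 0, L > 0 and λ₀ ∈ (0, 1], and for every Bochner-integrable function f : ℝ → H supported in [−L, L] that satisfies ∫_ℝ ‖f(t)‖_H dt + ( ∫_ℝ (1 + λ²)^σ ‖f̂(λ)‖²_H dλ )^{1/2} ≤ K, where f̂(λ) = ∫_ℝ e^{−iλt} f(t) dt, if moreover 0 < s := sup_{|λ| ≤ λ₀} ‖f̂(λ)‖_H < 1, then ( ∫_ℝ ‖f(t)‖²_H dt )^{1/2} ≤ C · max(1, K)² · e^{2Lλ₀} · λ₀^{−1/2 − 2σ} · ( log(1/s) )^{−σ/(3(σ+1))}. -/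
open MeasureTheory

open scoped FourierTransform SchwartzMap in
/-- Plancherel's identity for an integrable function whose Fourier transform is in `L²`. -/
theorem eLpNorm_two_fourier_eq {H : Type*} [NormedAddCommGroup H] [InnerProductSpace ℂ H]
    [CompleteSpace H] {f : ℝ → H} (hf : Integrable f) (h : MemLp (𝓕 f) 2) :
    eLpNorm f 2 volume = eLpNorm (𝓕 f) 2 volume := by
  set u : Lp H 2 (volume : Measure ℝ) := 𝓕⁻ (h.toLp (𝓕 f)) with hu
  have key : f =ᵐ[volume] u := by
    refine ae_eq_of_integral_contDiff_smul_eq hf.locallyIntegrable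
      ((Lp.memLp u).locallyIntegrable (by norm_num)) fun g g_smooth g_cpt => ?_
    have hg₁ : HasCompactSupport (Complex.ofRealCLM ∘ g) := g_cpt.comp_left rfl
    have hg₂ : ContDiff ℝ (⊤ : ℕ∞) (Complex.ofRealCLM ∘ g) :=
      Complex.ofRealCLM.contDiff.comp g_smooth
    set φ : 𝓢(ℝ, ℂ) := hg₁.toSchwartzMap hg₂ with hφ
    set ψ : 𝓢(ℝ, ℂ) := 𝓕⁻ φ with hψ
    have h1 : ∫ x, g x • (u x) = Lp.toTemperedDistribution u φ := by
      simp [φ, Lp.toTemperedDistribution_apply]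
    have h2 : Lp.toTemperedDistribution u φ = ∫ x, ψ x • (𝓕 f) x := by
      rw [hu, ← Lp.fourierInv_toTemperedDistribution_eq, TemperedDistribution.fourierInv_apply,
        Lp.toTemperedDistribution_apply]
      refine integral_congr_ae ?_
      filter_upwards [h.coeFn_toLp] with x hx
      rw [hx]
    have h3 : ∫ x, (𝓕 (⇑ψ) : ℝ → ℂ) x • f x = ∫ x, ψ x • (𝓕 f) x := by
      simpa using! (VectorFourier.integral_fourierIntegral_smul_eq_flip (L := innerₗ ℝ)
        Real.continuous_fourierChar continuous_inner ψ.integrable hf)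
    rw [h1, h2, ← h3]
    have h4 : (𝓕 (⇑ψ) : ℝ → ℂ) = φ := by
      rw [← SchwartzMap.fourier_coe, hψ, FourierTransform.fourier_fourierInv_eq]
    rw [h4]
    simp [φ]
  rw [eLpNorm_congr_ae key]
  have h5 : ‖u‖ = ‖h.toLp (𝓕 f)‖ := by
    rw [← Lp.norm_fourier_eq u, hu, FourierTransform.fourier_fourierInv_eq]
  rw [← eLpNorm_congr_ae h.coeFn_toLp]
  rw [Lp.norm_def, Lp.norm_def] at h5
  exact (ENNReal.toReal_eq_toReal_iff' (Lp.memLp u).eLpNorm_ne_top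
    (Lp.memLp _).eLpNorm_ne_top).1 h5

/-- The function `V z = √(z - i) √(z + i) - z` on the right half-plane: its real part is at most the
indicator of `[-i, i]` on the imaginary axis, and is bounded below inside. -/
theorem exists_halfPlane_minorant :
    ∃ V : ℂ → ℂ, DiffContOnCl ℂ V {z | 0 < z.re} ∧
      (∀ z : ℂ, ‖V z‖ ≤ 2 * ‖z‖ + 1) ∧
      (∀ v : ℝ, 1 ≤ |v| → (V (v * Complex.I)).re ≤ 0) ∧
      (∀ v : ℝ, (V (v * Complex.I)).re ≤ 1) ∧
      (∀ x : ℝ, 0 ≤ x → ‖V x‖ ≤ 1) ∧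
      ∀ z : ℂ, 0 < z.re → z.re / (4 * ‖z‖ ^ 2 + 2) ≤ (V z).re := by
  set S : ℂ → ℂ := fun z => (z - Complex.I) ^ (2⁻¹ : ℂ) * (z + Complex.I) ^ (2⁻¹ : ℂ) with hS
  have hsq (z : ℂ) : S z ^ 2 = z ^ 2 + 1 := by
    have h1 := Complex.cpow_nat_inv_pow (z - Complex.I) (n := 2) two_ne_zero
    have h2 := Complex.cpow_nat_inv_pow (z + Complex.I) (n := 2) two_ne_zero
    push_cast at h1 h2
    simp only [hS, mul_pow, h1, h2]
    linear_combination -Complex.I_sq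
  have hnormsq (z : ℂ) : ‖S z‖ ^ 2 ≤ ‖z‖ ^ 2 + 1 := by
    rw [← norm_pow, hsq]
    exact (norm_add_le _ _).trans (by simp)
  have hroot {w : ℂ} (hw : 0 ≤ w.re) : |(w ^ (2⁻¹ : ℂ)).im| ≤ (w ^ (2⁻¹ : ℂ)).re := by
    have h1 := Complex.cpow_nat_inv_pow w (n := 2) two_ne_zero
    push_cast at h1
    have h2 : 0 ≤ (w ^ (2⁻¹ : ℂ)).re := by
      rcases eq_or_ne w 0 with rfl | h0
      · simp
      rw [Complex.cpow_def_of_ne_zero h0, Complex.exp_re]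
      have him : (Complex.log w * 2⁻¹).im = w.arg / 2 := by
        simp [Complex.mul_im, Complex.log_im, div_eq_mul_inv]
      rw [him]
      refine mul_nonneg (Real.exp_pos _).le (Real.cos_nonneg_of_mem_Icc ⟨?_, ?_⟩)
      · linarith [Complex.neg_pi_lt_arg w]
      · linarith [Complex.arg_le_pi w]
    have h3 := congrArg Complex.re h1
    simp only [pow_two, Complex.mul_re] at h3
    exact abs_le_of_sq_le_sq (by nlinarith) h2
  have hre {z : ℂ} (hz : 0 ≤ z.re) : 0 ≤ (S z).re := by
    have h1 := hroot (w := z - Complex.I) (by simpa)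
    have h2 := hroot (w := z + Complex.I) (by simpa)
    simp only [hS, Complex.mul_re]
    have := mul_le_mul h1 h2 (abs_nonneg _) ((abs_nonneg _).trans h1)
    rw [← abs_mul] at this
    linarith [le_abs_self (((z - Complex.I) ^ (2⁻¹ : ℂ)).im * ((z + Complex.I) ^ (2⁻¹ : ℂ)).im)]
  have hcont {w : ℂ} (hw : 0 ≤ w.re) : ContinuousAt (fun w : ℂ => w ^ (2⁻¹ : ℂ)) w := by
    rcases eq_or_ne w 0 with rfl | h0
    · exact Complex.continuousAt_cpow_const_of_re_pos (Or.inl (by simp)) (by norm_num)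
    · by_cases hs : w ∈ Complex.slitPlane
      · exact continuousAt_cpow_const hs
      · exact absurd (by
          rw [Complex.mem_slitPlane_iff]
          by_contra! h
          exact h0 (Complex.ext (le_antisymm h.1 hw) h.2)) hs
  have hprod (z : ℂ) : (S z - z) * (S z + z) = 1 := by linear_combination hsq z
  refine ⟨fun z => S z - z, ⟨?_, ?_⟩, fun z => ?_, fun v hv => ?_, fun v => ?_, fun x hx => ?_,
    fun z hz => ?_⟩
  · intro z (hz : 0 < z.re)
    have h1 : z - Complex.I ∈ Complex.slitPlane := Or.inl (by simpa)
    have h2 : z + Complex.I ∈ Complex.slitPlane := Or.inl (by simpa)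
    refine DifferentiableAt.differentiableWithinAt ?_
    refine DifferentiableAt.sub (DifferentiableAt.mul ?_ ?_) differentiableAt_id
    · exact (differentiableAt_id.sub_const _).cpow_const h1
    · exact (differentiableAt_id.add_const _).cpow_const h2
  · rw [Complex.closure_setOfPred_lt_re]
    intro z (hz : 0 ≤ z.re)
    refine ContinuousAt.continuousWithinAt ?_
    refine ContinuousAt.sub (ContinuousAt.mul ?_ ?_) continuousAt_id
    · exact (hcont (w := z - Complex.I) (by simpa)).comp (f := fun z => z - Complex.I)
        (by fun_prop)
    · exact (hcont (w := z + Complex.I) (by simpa)).comp (f := fun z => z + Complex.I)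
        (by fun_prop)
  · have : ‖S z‖ ≤ ‖z‖ + 1 := by
      refine abs_le_of_sq_le_sq' ?_ (by positivity) |>.2
      nlinarith [hnormsq z, norm_nonneg z]
    linarith [norm_sub_le (S z) z]
  · have h1 := hsq (v * Complex.I)
    have h2 := congrArg Complex.re h1
    have h3 := congrArg Complex.im h1
    have hv2 : 1 ≤ v ^ 2 := (one_le_sq_iff_one_le_abs v).2 hv
    simp [pow_two] at h2 h3
    simp only [Complex.sub_re, Complex.mul_re, Complex.ofReal_re, Complex.I_re, mul_zero,
      Complex.ofReal_im, zero_mul, sub_zero]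
    by_contra! h
    have him : (S (v * Complex.I)).im = 0 := by
      have : (S (v * Complex.I)).re * (S (v * Complex.I)).im = 0 := by linarith
      exact (mul_eq_zero.1 this).resolve_left h.ne'
    rw [him] at h2
    nlinarith
  · have h1 := hsq (v * Complex.I)
    have h2 := congrArg Complex.re h1
    have h3 := congrArg Complex.im h1
    simp [pow_two] at h2 h3
    simp only [Complex.sub_re, Complex.mul_re, Complex.ofReal_re, Complex.I_re, mul_zero,
      Complex.ofReal_im, zero_mul, sub_zero]
    by_contra! h
    have him : (S (v * Complex.I)).im = 0 := by
      have : (S (v * Complex.I)).re * (S (v * Complex.I)).im = 0 := by linarith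
      exact (mul_eq_zero.1 this).resolve_left (by linarith)
    rw [him] at h2
    nlinarith
  · have h1 : ‖S x - x‖ ≤ ‖S x + x‖ := by
      refine abs_le_of_sq_le_sq' ?_ (norm_nonneg _) |>.2
      rw [Complex.sq_norm, Complex.sq_norm, Complex.normSq_apply, Complex.normSq_apply]
      have := mul_nonneg hx (hre (z := x) (by simpa))
      simp only [Complex.sub_re, Complex.sub_im, Complex.add_re, Complex.add_im,
        Complex.ofReal_re, Complex.ofReal_im]
      nlinarith
    have h2 : ‖S x - x‖ * ‖S x + x‖ = 1 := by rw [← norm_mul, hprod, norm_one]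
    nlinarith [norm_nonneg (S x - x)]
  · have h1 : S z - z = (S z + z)⁻¹ := eq_inv_of_mul_eq_one_left (hprod z)
    have h2 : 0 < Complex.normSq (S z + z) := by
      rw [Complex.normSq_pos]
      intro h
      simpa [h] using hprod z
    have h3 : Complex.normSq (S z + z) ≤ 4 * ‖z‖ ^ 2 + 2 := by
      rw [← Complex.sq_norm]
      have := norm_add_le (S z) z
      nlinarith [hnormsq z, norm_nonneg (S z + z), sq_nonneg (‖S z‖ - ‖z‖)]
    simp only [h1, Complex.inv_re]
    have h4 := hre hz.le
    exact div_le_div₀ (by rw [Complex.add_re]; linarith) (by rw [Complex.add_re]; linarith) h2 h3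

/-- A two-constants estimate in the right half-plane: smallness on a segment of the imaginary axis
propagates inside. -/
theorem norm_le_exp_neg_of_small_on_segment {E : Type*} [NormedAddCommGroup E] [NormedSpace ℂ E]
    {g : ℂ → E} {M a l : ℝ} (ha : 0 < a) (hl : 0 ≤ l)
    (hg : DiffContOnCl ℂ g {z | 0 < z.re}) (hM : ∀ z : ℂ, 0 ≤ z.re → ‖g z‖ ≤ M)
    (hs : ∀ v : ℝ, |v| ≤ a → ‖g (v * Complex.I)‖ ≤ M * Real.exp (-l)) {z : ℂ} (hz : 0 < z.re) :
    ‖g z‖ ≤ M * Real.exp (-(l * ((z / a).re / (4 * ‖z / a‖ ^ 2 + 2)))) := by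
  obtain ⟨V, hV, hVgrowth, hVout, hVin, hVreal, hVlow⟩ := exists_halfPlane_minorant
  have hM0 : 0 ≤ M := (norm_nonneg _).trans (hM 0 (by simp))
  have hmaps : Set.MapsTo (fun w : ℂ => w / a) {z | 0 < z.re} {z | 0 < z.re} := fun w hw => by
    simpa using div_pos hw ha
  have hVd : DiffContOnCl ℂ (fun w : ℂ => V (w / a)) {z | 0 < z.re} :=
    hV.comp (f := V) (g := fun w : ℂ => w / a)
      (Differentiable.diffContOnCl (by fun_prop)) hmaps
  have hexp : DiffContOnCl ℂ (fun w : ℂ => Complex.exp (l * V (w / a))) {z | 0 < z.re} :=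
    Complex.differentiable_exp.comp_diffContOnCl (hVd.const_smul (l : ℂ))
  have hnorm (w : ℂ) : ‖Complex.exp (l * V (w / a)) • g w‖
      = Real.exp (l * (V (w / a)).re) * ‖g w‖ := by
    rw [norm_smul, Complex.norm_exp]
    simp
  have key : ‖Complex.exp (l * V (z / a)) • g z‖ ≤ M := by
    refine PhragmenLindelof.right_half_plane_of_bounded_on_real
      (f := fun w : ℂ => Complex.exp (l * V (w / a)) • g w) (hexp.smul hg)
      ⟨1, by norm_num, 2 * l / a, ?_⟩ ?_ (fun v => ?_) hz.le
    · refine Asymptotics.IsBigO.of_bound (Real.exp l * M) ?_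
      refine Filter.eventually_inf_principal.2 (Filter.Eventually.of_forall fun w hw => ?_)
      rw [hnorm, Real.norm_of_nonneg (Real.exp_pos _).le, Real.rpow_one]
      calc Real.exp (l * (V (w / a)).re) * ‖g w‖
          ≤ Real.exp (l * (2 * (‖w‖ / a) + 1)) * M := by
            gcongr
            · have := hVgrowth (w / a)
              rw [norm_div, Complex.norm_real, Real.norm_of_nonneg ha.le] at this
              exact (Complex.re_le_norm _).trans this
            · exact hM w (le_of_lt hw)
        _ = Real.exp l * M * Real.exp (2 * l / a * ‖w‖) := by
            rw [show l * (2 * (‖w‖ / a) + 1) = l + 2 * l / a * ‖w‖ by ring, Real.exp_add]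
            ring
    · refine Filter.isBoundedUnder_of_eventually_le (a := Real.exp (l * 1) * M) ?_
      filter_upwards [Filter.eventually_ge_atTop 0] with x hx
      rw [hnorm]
      gcongr
      · have := hVreal (x / a) (by positivity)
        push_cast at this
        exact (Complex.re_le_norm _).trans this
      · exact hM _ (by simpa)
    · have hva : (v * Complex.I / a : ℂ) = ((v / a : ℝ) : ℂ) * Complex.I := by
        push_cast; ring
      rw [hnorm, hva]
      rcases le_total |v| a with h | h
      · calc _ ≤ Real.exp (l * 1) * (M * Real.exp (-l)) := by
              gcongr
              · exact hVin _
              · exact hs v h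
          _ = M := by
              rw [mul_left_comm, ← Real.exp_add]
              simp
      · calc _ ≤ 1 * M := by
              gcongr
              · refine Real.exp_le_one_iff.2 (mul_nonpos_of_nonneg_of_nonpos hl (hVout _ ?_))
                rw [abs_div, abs_of_pos ha]
                exact (one_le_div ha).2 h
              · exact hM _ (by simp)
          _ = M := one_mul M
  rw [hnorm] at key
  rw [Real.exp_neg, ← div_eq_mul_inv, le_div_iff₀ (Real.exp_pos _), mul_comm]
  refine le_trans ?_ key
  gcongr
  exact hVlow _ (by simpa using div_pos hz ha)

section
variable {H : Type*} [NormedAddCommGroup H] [NormedSpace ℂ H] {f : ℝ → H} {L : ℝ}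

theorem integrable_exp_smul (hf : Integrable f) (hsupp : Function.support f ⊆ Set.Icc (-L) L)
    (z : ℂ) : Integrable fun t : ℝ => Complex.exp (z * (t - L : ℝ)) • f t := by
  have h1 : IntegrableOn (fun t : ℝ => Complex.exp (z * (t - L : ℝ)) • f t) (Set.Icc (-L) L) :=
    hf.integrableOn.continuousOn_smul (Continuous.continuousOn (by fun_prop)) isCompact_Icc
  exact (integrableOn_iff_integrable_of_support_subset
    ((Function.support_smul_subset_right _ _).trans hsupp)).1 h1

theorem differentiable_integral_exp_smul (hf : Integrable f)
    (hsupp : Function.support f ⊆ Set.Icc (-L) L) :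
    Differentiable ℂ fun z : ℂ => ∫ t : ℝ, Complex.exp (z * (t - L : ℝ)) • f t := by
  intro z₀
  refine (hasDerivAt_integral_of_dominated_loc_of_deriv_le (Metric.ball_mem_nhds z₀ one_pos)
    (F' := fun z t => (Complex.exp (z * (t - L : ℝ)) * (t - L : ℝ)) • f t)
    (bound := fun t => (Real.exp ((‖z₀‖ + 1) * (2 * L)) * (2 * L)) * ‖f t‖)
    ?_ (integrable_exp_smul hf hsupp z₀) ?_ ?_ (hf.norm.const_mul _) ?_).2.differentiableAt
  · exact Filter.Eventually.of_forall fun z => (integrable_exp_smul hf hsupp z).1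
  · exact AEStronglyMeasurable.smul (Continuous.aestronglyMeasurable (by fun_prop)) hf.1
  · refine Filter.Eventually.of_forall fun t z hz => ?_
    by_cases ht : f t = 0
    · simp [ht]
    have ht' := hsupp ht
    have hz' : ‖z‖ ≤ ‖z₀‖ + 1 := by
      have h1 := mem_ball_iff_norm.1 hz
      have h2 := norm_le_norm_add_norm_sub' z z₀
      linarith
    have htL : ‖((t - L : ℝ) : ℂ)‖ ≤ 2 * L := by
      rw [Complex.norm_real, Real.norm_eq_abs, abs_le]
      constructor <;> linarith [ht'.1, ht'.2]
    rw [norm_smul, norm_mul]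
    gcongr
    refine (Complex.norm_exp_le_exp_norm _).trans (Real.exp_le_exp.2 ?_)
    rw [norm_mul]
    gcongr
  · refine Filter.Eventually.of_forall fun t z _ => ?_
    have h1 : HasDerivAt (fun z : ℂ => Complex.exp (z * (t - L : ℝ)))
        (Complex.exp (z * (t - L : ℝ)) * (t - L : ℝ)) z := by
      simpa using ((hasDerivAt_id z).mul_const ((t - L : ℝ) : ℂ)).cexp
    exact h1.smul_const (f t)

theorem norm_integral_exp_smul_le (hf : Integrable f)
    (hsupp : Function.support f ⊆ Set.Icc (-L) L) {z : ℂ} (hz : 0 ≤ z.re) :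
    ‖∫ t : ℝ, Complex.exp (z * (t - L : ℝ)) • f t‖ ≤ ∫ t, ‖f t‖ := by
  refine norm_integral_le_of_norm_le hf.norm (Filter.Eventually.of_forall fun t => ?_)
  by_cases ht : f t = 0
  · simp [ht]
  rw [norm_smul, Complex.norm_exp, Complex.re_mul_ofReal]
  refine mul_le_of_le_one_left (norm_nonneg _) (Real.exp_le_one_iff.2 ?_)
  exact mul_nonpos_of_nonneg_of_nonpos hz (by linarith [(hsupp ht).2])

theorem norm_integral_exp_smul_sub_le (hf : Integrable f)
    (hsupp : Function.support f ⊆ Set.Icc (-L) L) {y : ℝ} (hy : 0 ≤ y) {z : ℂ} (hz : z.re = 0) :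
    ‖(∫ t : ℝ, Complex.exp (z * (t - L : ℝ)) • f t) -
      ∫ t : ℝ, Complex.exp ((z + y) * (t - L : ℝ)) • f t‖ ≤ 2 * L * y * ∫ t, ‖f t‖ := by
  rw [← integral_sub (integrable_exp_smul hf hsupp _) (integrable_exp_smul hf hsupp _),
    ← integral_const_mul]
  refine norm_integral_le_of_norm_le (hf.norm.const_mul _)
    (Filter.Eventually.of_forall fun t => ?_)
  by_cases ht : f t = 0
  · simp [ht]
  obtain ⟨h1, h2⟩ := hsupp ht
  have h3 : Complex.exp (z * (t - L : ℝ)) • f t - Complex.exp ((z + y) * (t - L : ℝ)) • f t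
      = (Complex.exp (z * (t - L : ℝ)) * ((1 - Real.exp (y * (t - L)) : ℝ) : ℂ)) • f t := by
    rw [← sub_smul, add_mul, Complex.exp_add]
    push_cast
    congr 1
    ring
  rw [h3, norm_smul, norm_mul, Complex.norm_exp, Complex.re_mul_ofReal, hz, zero_mul,
    Real.exp_zero, one_mul, Complex.norm_real, Real.norm_eq_abs]
  gcongr
  have h4 : y * (t - L) ≤ 0 := mul_nonpos_of_nonneg_of_nonpos hy (by linarith)
  rw [abs_of_nonneg (sub_nonneg.2 (Real.exp_le_one_iff.2 h4))]
  nlinarith [Real.add_one_le_exp (y * (t - L))]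

end

open scoped FourierTransform in
theorem eLpNorm_two_le_sqrt_integral {H : Type*} [NormedAddCommGroup H] [InnerProductSpace ℂ H]
    [CompleteSpace H] {f fhat : ℝ → H} (hf : Integrable f)
    (hfhat : ∀ l : ℝ, fhat l = ∫ t : ℝ, Complex.exp (-(Complex.I * (l : ℂ) * (t : ℂ))) • f t)
    (hint : Integrable fun l => ‖fhat l‖ ^ 2) :
    eLpNorm f 2 volume ≤ ENNReal.ofReal (Real.sqrt (∫ l, ‖fhat l‖ ^ 2)) := by
  have hF : 𝓕 f = fun x : ℝ => fhat (x * (2 * Real.pi)) := by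
    ext x
    rw [Real.fourier_eq', hfhat]
    congr 1
    ext t
    congr 2
    simp only [RCLike.inner_apply, conj_trivial]
    push_cast
    ring
  have hcont : Continuous (𝓕 f) :=
    VectorFourier.fourierIntegral_continuous Real.continuous_fourierChar
      continuous_inner hf
  have hint' : Integrable fun x => ‖𝓕 f x‖ ^ 2 := by
    rw [hF]
    exact hint.comp_mul_right' (by positivity)
  have hmem : MemLp (𝓕 f) 2 := (memLp_two_iff_integrable_sq_norm hcont.aestronglyMeasurable).2 hint'
  rw [eLpNorm_two_fourier_eq hf hmem, hmem.eLpNorm_eq_integral_rpow_norm (by norm_num) (by norm_num)]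
  refine ENNReal.ofReal_le_ofReal ?_
  simp only [ENNReal.toReal_ofNat, Real.rpow_ofNat]
  rw [Real.sqrt_eq_rpow, one_div]
  refine Real.rpow_le_rpow (integral_nonneg fun _ => by positivity) ?_ (by norm_num)
  rw [hF]
  have h1 := Measure.integral_comp_mul_right (fun l => ‖fhat l‖ ^ 2) (2 * Real.pi)
  simp only at h1 ⊢
  rw [h1, smul_eq_mul]
  refine mul_le_of_le_one_left (integral_nonneg fun _ => by positivity) ?_
  rw [abs_of_pos (by positivity)]
  exact inv_le_one_of_one_le₀ (by linarith [Real.pi_gt_three])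

theorem integrable_sq_norm_of_weighted {H : Type*} [NormedAddCommGroup H] {u : ℝ → H} {σ : ℝ}
    (hσ : 0 ≤ σ) (hu : Continuous u) (hint : Integrable fun l : ℝ => (1 + l ^ 2) ^ σ * ‖u l‖ ^ 2) :
    Integrable fun l => ‖u l‖ ^ 2 := by
  refine hint.mono' (by fun_prop) (Filter.Eventually.of_forall fun l => ?_)
  rw [Real.norm_of_nonneg (by positivity)]
  exact le_mul_of_one_le_left (by positivity)
    (Real.one_le_rpow (by linarith [sq_nonneg l]) hσ)

theorem integral_sq_norm_le_of_weighted {H : Type*} [NormedAddCommGroup H] {u : ℝ → H} {σ : ℝ}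
    (hσ : 0 ≤ σ) (hu : Continuous u) (hint : Integrable fun l : ℝ => (1 + l ^ 2) ^ σ * ‖u l‖ ^ 2) :
    ∫ l, ‖u l‖ ^ 2 ≤ ∫ l : ℝ, (1 + l ^ 2) ^ σ * ‖u l‖ ^ 2 := by
  refine integral_mono (integrable_sq_norm_of_weighted hσ hu hint) hint fun l => ?_
  exact le_mul_of_one_le_left (by positivity)
    (Real.one_le_rpow (by linarith [sq_nonneg l]) hσ)

theorem integral_sq_norm_le_of_low_high {H : Type*} [NormedAddCommGroup H] {u : ℝ → H} {σ R B : ℝ}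
    (hσ : 0 ≤ σ) (hu : Continuous u) (hint : Integrable fun l : ℝ => (1 + l ^ 2) ^ σ * ‖u l‖ ^ 2)
    (hR : 0 < R) (hB : ∀ l, |l| ≤ R → ‖u l‖ ≤ B) :
    ∫ l, ‖u l‖ ^ 2 ≤ 2 * R * B ^ 2 + R ^ (-(2 * σ)) * ∫ l : ℝ, (1 + l ^ 2) ^ σ * ‖u l‖ ^ 2 := by
  have hu2 := integrable_sq_norm_of_weighted hσ hu hint
  rw [← integral_add_compl (s := Set.Icc (-R) R) measurableSet_Icc hu2]
  refine add_le_add ?_ ?_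
  · have h1 : ∫ l in Set.Icc (-R) R, ‖u l‖ ^ 2 ≤ ∫ l in Set.Icc (-R) R, B ^ 2 := by
      refine setIntegral_mono_on hu2.integrableOn (integrableOn_const (by simp)) measurableSet_Icc
        fun l hl => ?_
      have := hB l (abs_le.2 hl)
      gcongr
    refine h1.trans_eq ?_
    rw [setIntegral_const, Real.volume_real_Icc_of_le (by linarith), smul_eq_mul]
    ring
  · have h2 : ∫ l in (Set.Icc (-R) R)ᶜ, ‖u l‖ ^ 2
        ≤ ∫ l in (Set.Icc (-R) R)ᶜ, R ^ (-(2 * σ)) * ((1 + l ^ 2) ^ σ * ‖u l‖ ^ 2) := by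
      refine setIntegral_mono_on hu2.integrableOn (hint.const_mul _).integrableOn
        measurableSet_Icc.compl fun l hl => ?_
      have hl' : R ≤ |l| := by
        by_contra! h
        exact hl (abs_le.1 h.le)
      rw [← mul_assoc]
      refine le_mul_of_one_le_left (by positivity) ?_
      rw [Real.rpow_neg hR.le, ← div_eq_inv_mul, one_le_div (by positivity), Real.rpow_mul hR.le]
      refine Real.rpow_le_rpow (by positivity) ?_ hσ
      rw [Real.rpow_two, ← sq_abs l]
      nlinarith
    refine h2.trans ?_
    rw [← integral_const_mul]
    exact setIntegral_le_integral (hint.const_mul _)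
      (Filter.Eventually.of_forall fun l => by simp only [Pi.zero_apply]; positivity)

theorem exists_exp_neg_rpow_le {θ γ : ℝ} (hθ : 0 < θ) :
    ∃ C > 0, ∀ x : ℝ, 1 ≤ x → Real.exp (-(x ^ θ / 10)) ≤ C * x ^ (-γ) := by
  obtain ⟨n, hn⟩ := exists_nat_ge (γ / θ)
  refine ⟨10 ^ n * n.factorial, by positivity, fun x hx => ?_⟩
  have hx0 : 0 < x := by linarith
  have h1 := Real.pow_div_factorial_le_exp (x ^ θ / 10) (by positivity) n
  have h2 : x ^ γ ≤ (x ^ θ) ^ n := by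
    rw [← Real.rpow_natCast, ← Real.rpow_mul hx0.le]
    refine Real.rpow_le_rpow_of_exponent_le hx ?_
    rw [div_le_iff₀ hθ] at hn
    linarith
  rw [div_pow, div_div, div_le_iff₀ (by positivity)] at h1
  rw [Real.exp_neg, Real.rpow_neg hx0.le, ← div_eq_mul_inv, le_div_iff₀ (by positivity),
    inv_mul_le_iff₀ (Real.exp_pos _)]
  exact h2.trans h1

theorem norm_fourier_le_of_small_on_segment {H : Type*} [NormedAddCommGroup H] [NormedSpace ℂ H]
    {f fhat : ℝ → H} {L M a r y : ℝ} (hf : Integrable f)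
    (hsupp : Function.support f ⊆ Set.Icc (-L) L)
    (hfhat : ∀ l : ℝ, fhat l = ∫ t : ℝ, Complex.exp (-(Complex.I * (l : ℂ) * (t : ℂ))) • f t)
    (ha : 0 < a) (hr : 0 ≤ r) (hM : ∫ t, ‖f t‖ ≤ M)
    (hs : ∀ l : ℝ, |l| ≤ a → ‖fhat l‖ ≤ M * Real.exp (-r)) (hy : 0 < y) (l : ℝ) :
    ‖fhat l‖ ≤ M * Real.exp (-(r * (y / (4 * (y ^ 2 + (l / a) ^ 2) + 2)))) +
      2 * L * (a * y) * ∫ t, ‖f t‖ := by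
  set g : ℂ → H := fun z => ∫ t : ℝ, Complex.exp (z * (t - L : ℝ)) • f t with hg
  have hgf (v : ℝ) : ‖fhat v‖ = ‖g ((-v : ℝ) * Complex.I)‖ := by
    have : g ((-v : ℝ) * Complex.I) = Complex.exp ((v * L : ℝ) * Complex.I) • fhat v := by
      rw [hfhat, hg, ← integral_smul]
      refine integral_congr_ae (Filter.Eventually.of_forall fun t => ?_)
      simp only
      rw [smul_smul, ← Complex.exp_add]
      congr 2
      push_cast
      ring
    rw [this, norm_smul, Complex.norm_exp_ofReal_mul_I, one_mul]
  have hsmall := norm_le_exp_neg_of_small_on_segment (g := g) (M := M) ha hr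
    (differentiable_integral_exp_smul hf hsupp).diffContOnCl
    (fun z hz => (norm_integral_exp_smul_le hf hsupp hz).trans hM)
    (fun v hv => by simpa [hgf] using hs (-v) (by simpa))
    (z := (-l : ℝ) * Complex.I + (a * y : ℝ)) (by simp; positivity)
  have hz : (((-l : ℝ) * Complex.I + (a * y : ℝ)) / a : ℂ)
      = ((y : ℝ) : ℂ) + ((-(l / a) : ℝ) : ℂ) * Complex.I := by
    have : (a : ℂ) ≠ 0 := by exact_mod_cast ha.ne'
    push_cast
    field_simp
    ring
  have hzre : ((y : ℝ) + ((-(l / a) : ℝ) : ℂ) * Complex.I : ℂ).re = y := by simp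
  rw [hz, Complex.sq_norm, Complex.normSq_add_mul_I, hzre, neg_sq] at hsmall
  have hsub := norm_integral_exp_smul_sub_le hf hsupp (y := a * y) (by positivity)
    (z := (-l : ℝ) * Complex.I) (by simp)
  rw [hgf]
  have := norm_le_norm_add_norm_sub' (g ((-l : ℝ) * Complex.I))
    (g ((-l : ℝ) * Complex.I + (a * y : ℝ)))
  linarith

/-- Quantitative unique continuation for the vector-valued Fourier transform
(Lemma 4.1 of Caro–Dos Santos Ferreira–Ruiz): for a Hilbert space `H` and `σ ∈ (0,1]`
there is `C > 0` depending only on `σ` such that for all `K, L > 0`, `l₀ ∈ (0,1]`, and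
every integrable `f : ℝ → H` supported in `[-L, L]` with
`‖f‖_{L¹} + ‖f‖_{H^σ} ≤ K`, if `0 < s := sup_{|l| ≤ l₀} ‖f̂(l)‖ < 1` then
`‖f‖_{L²} ≤ C max(1,K)² e^{2Ll₀} l₀^{-1/2-2σ} (log(1/s))^{-σ/(3(σ+1))}`. -/
theorem stmt7 (H : Type*) [NormedAddCommGroup H] [InnerProductSpace ℂ H] [CompleteSpace H]
    (σ : ℝ) (hσ : σ ∈ Set.Ioc (0 : ℝ) 1) :
    ∃ C > 0, ∀ (K L l₀ : ℝ), 0 < K → 0 < L → l₀ ∈ Set.Ioc (0 : ℝ) 1 →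
      ∀ (f : ℝ → H) (fhat : ℝ → H) (s : ℝ),
        Integrable f →
        Function.support f ⊆ Set.Icc (-L) L →
        (∀ l : ℝ, fhat l = ∫ t : ℝ, Complex.exp (-(Complex.I * (l : ℂ) * (t : ℂ))) • f t) →
        Integrable (fun l : ℝ => (1 + l^2) ^ σ * ‖fhat l‖^2) →
        (∫ t : ℝ, ‖f t‖) + Real.sqrt (∫ l : ℝ, (1 + l^2) ^ σ * ‖fhat l‖^2) ≤ K →
        s = ⨆ l : {l : ℝ // |l| ≤ l₀}, ‖fhat l.1‖ →
        0 < s → s < 1 →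
        eLpNorm f 2 volume ≤ ENNReal.ofReal
          (C * (max 1 K)^2 * Real.exp (2 * L * l₀) * l₀ ^ (-(1/2 : ℝ) - 2 * σ) *
            Real.log (1 / s) ^ (-(σ / (3 * (σ + 1))))) := by
  obtain ⟨hσ0, hσ1⟩ := hσ
  set β : ℝ := 1 / (3 * (σ + 1)) with hβ
  set κ : ℝ := σ / (3 * (σ + 1)) with hκ
  set γ : ℝ := κ + β / 2 with hγ
  have hβ0 : 0 < β := by positivity
  have hκ0 : 0 < κ := by positivity
  have hγ0 : 0 < γ := by positivity
  have hβσ : β * σ = κ := by rw [hβ, hκ]; ring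
  have hsum : 3 * κ + 3 * β = 1 := by rw [hβ, hκ]; field_simp
  have hθ : 0 < 1 - γ - 2 * β := by linarith
  obtain ⟨C₁, hC₁, hexp⟩ := exists_exp_neg_rpow_le (γ := γ) hθ
  set C : ℝ := 2 * (1 + C₁) ^ 2 + 1 with hC
  have hC1 : 1 ≤ C := by
    rw [hC]
    linarith [sq_nonneg (1 + C₁)]
  refine ⟨C, by linarith, fun K L a hK hL ⟨ha0, ha1⟩ f fhat s hf hsupp hfhat hint hbound hs hs0 hs1
    => ?_⟩
  set M := max 1 K
  have hM1 : 1 ≤ M := le_max_left _ _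
  set r := Real.log (1 / s) with hr
  have hr0 : 0 < r := Real.log_pos (by rwa [one_div, one_lt_inv₀ hs0])
  set W := ∫ l : ℝ, (1 + l^2) ^ σ * ‖fhat l‖^2 with hW
  have hW0 : 0 ≤ W := integral_nonneg fun l => by positivity
  have hf0 : 0 ≤ ∫ t, ‖f t‖ := integral_nonneg fun t => norm_nonneg _
  have hfM : ∫ t, ‖f t‖ ≤ M :=
    (by linarith [Real.sqrt_nonneg W] : ∫ t, ‖f t‖ ≤ K).trans (le_max_right _ _)
  have hWM : W ≤ M ^ 2 := by
    rw [← Real.sqrt_le_left (by linarith)]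
    exact (by linarith : Real.sqrt W ≤ K).trans (le_max_right _ _)
  have hfhat_le (l : ℝ) : ‖fhat l‖ ≤ ∫ t, ‖f t‖ := by
    rw [hfhat]
    refine norm_integral_le_of_norm_le hf.norm (Filter.Eventually.of_forall fun t => ?_)
    rw [norm_smul, Complex.norm_exp]
    simp
  have hcont : Continuous fhat := by
    rw [funext hfhat]
    refine continuous_of_dominated (bound := fun t => ‖f t‖) (fun l => ?_) (fun l => ?_) hf.norm ?_
    · exact AEStronglyMeasurable.smul (Continuous.aestronglyMeasurable (by fun_prop)) hf.1
    · refine Filter.Eventually.of_forall fun t => ?_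
      rw [norm_smul, Complex.norm_exp]
      simp
    · exact Filter.Eventually.of_forall fun t => by fun_prop
  set E := Real.exp (2 * L * a) with hE
  have hE1 : 1 ≤ E := Real.one_le_exp (by positivity)
  set P := a ^ (-(1/2 : ℝ) - 2 * σ) with hP
  have hP1 : 1 ≤ P := Real.one_le_rpow_of_pos_of_le_one_of_nonpos ha0 ha1 (by linarith)
  have hPsq {e : ℝ} (he : -1 - 4 * σ ≤ e) : a ^ e ≤ P ^ 2 := by
    rw [hP, ← Real.rpow_natCast, ← Real.rpow_mul ha0.le]
    exact Real.rpow_le_rpow_of_exponent_ge ha0 ha1 (by push_cast; linarith)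
  refine (eLpNorm_two_le_sqrt_integral hf hfhat
    (integrable_sq_norm_of_weighted hσ0.le hcont hint)).trans (ENNReal.ofReal_le_ofReal ?_)
  refine Real.sqrt_le_iff.2 ⟨by positivity, ?_⟩
  have hMM : M ^ 2 ≤ (M ^ 2) ^ 2 := le_self_pow₀ (one_le_pow₀ hM1) two_ne_zero
  have hCC : C ≤ C ^ 2 := by nlinarith
  suffices h : ∫ l, ‖fhat l‖ ^ 2 ≤ C * M ^ 2 * E ^ 2 * P ^ 2 * (r ^ (-κ)) ^ 2 by
    refine h.trans ?_
    rw [mul_pow, mul_pow, mul_pow, mul_pow]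
    gcongr
  rcases le_or_gt r 1 with hr1 | hr1
  · have hrκ : 1 ≤ r ^ (-κ) := Real.one_le_rpow_of_pos_of_le_one_of_nonpos hr0 hr1 (by linarith)
    refine ((integral_sq_norm_le_of_weighted hσ0.le hcont hint).trans hWM).trans ?_
    calc M ^ 2 = 1 * M ^ 2 * 1 ^ 2 * 1 ^ 2 * 1 ^ 2 := by ring
      _ ≤ _ := by gcongr
  have hpow (p q : ℝ) : r ^ p * r ^ q = r ^ (p + q) := (Real.rpow_add hr0 p q).symm
  have hlow (l : ℝ) (hl : |l| ≤ a * r ^ β) : ‖fhat l‖ ≤ (1 + C₁) * M * E * r ^ (-γ) := by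
    have hsmall (v : ℝ) (hv : |v| ≤ a) : ‖fhat v‖ ≤ M * Real.exp (-r) := by
      have h1 : ‖fhat v‖ ≤ s := by
        rw [hs]
        exact le_ciSup (f := fun l : {l : ℝ // |l| ≤ a} => ‖fhat l.1‖)
          ⟨∫ t, ‖f t‖, by rintro _ ⟨l, rfl⟩; exact hfhat_le _⟩ ⟨v, hv⟩
      have h2 : Real.exp (-r) = s := by
        rw [hr, one_div, Real.log_inv, neg_neg, Real.exp_log hs0]
      rw [h2]
      nlinarith
    have h1 := norm_fourier_le_of_small_on_segment (y := r ^ (-γ)) hf hsupp hfhat ha0 hr0.le hfM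
      hsmall (by positivity) l
    have hla : (l / a) ^ 2 ≤ r ^ (2 * β) := by
      rw [two_mul, ← hpow, ← sq, ← sq_abs (l / a), abs_div, abs_of_pos ha0]
      gcongr
      rwa [div_le_iff₀' ha0]
    have hy : (r ^ (-γ)) ^ 2 ≤ r ^ (2 * β) := by
      rw [sq, hpow]
      exact Real.rpow_le_rpow_of_exponent_le hr1.le (by linarith)
    have h1β : 1 ≤ r ^ (2 * β) := Real.one_le_rpow hr1.le (by linarith)
    have h2 : r ^ (1 - γ - 2 * β) / 10
        ≤ r * (r ^ (-γ) / (4 * ((r ^ (-γ)) ^ 2 + (l / a) ^ 2) + 2)) := by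
      have h3 : r ^ (1 - γ - 2 * β) / 10 = r * (r ^ (-γ) / (10 * r ^ (2 * β))) := by
        rw [sub_sub, sub_eq_add_neg, neg_add, Real.rpow_add hr0, Real.rpow_add hr0, Real.rpow_one,
          Real.rpow_neg hr0.le (2 * β)]
        field_simp
      rw [h3]
      gcongr
      linarith
    have h4 : M * Real.exp (-(r * (r ^ (-γ) / (4 * ((r ^ (-γ)) ^ 2 + (l / a) ^ 2) + 2))))
        ≤ C₁ * M * E * r ^ (-γ) := by
      calc _ ≤ M * (C₁ * r ^ (-γ)) := by
            gcongr
            exact (Real.exp_le_exp.2 (neg_le_neg h2)).trans (hexp r hr1.le)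
        _ = C₁ * M * 1 * r ^ (-γ) := by ring
        _ ≤ _ := by gcongr
    have h5 : 2 * L * (a * r ^ (-γ)) * ∫ t, ‖f t‖ ≤ E * r ^ (-γ) * M := by
      rw [show 2 * L * (a * r ^ (-γ)) = 2 * L * a * r ^ (-γ) by ring]
      gcongr
      linarith [Real.add_one_le_exp (2 * L * a)]
    linarith
  have hmain := integral_sq_norm_le_of_low_high hσ0.le hcont hint
    (R := a * r ^ β) (by positivity) hlow
  refine hmain.trans ?_
  have hκ2 : (r ^ (-κ)) ^ 2 = r ^ (-(2 * κ)) := by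
    rw [sq, hpow]
    ring_nf
  have h1 : 2 * (a * r ^ β) * ((1 + C₁) * M * E * r ^ (-γ)) ^ 2
      ≤ 2 * (1 + C₁) ^ 2 * M ^ 2 * E ^ 2 * P ^ 2 * (r ^ (-κ)) ^ 2 := by
    have h2 : r ^ β * (r ^ (-γ)) ^ 2 = (r ^ (-κ)) ^ 2 := by
      rw [hκ2, sq, hpow, hpow]
      congr 1
      rw [hγ]
      ring
    have h3 : a ≤ P ^ 2 := by
      simpa using hPsq (e := 1) (by linarith)
    calc _ = 2 * (1 + C₁) ^ 2 * M ^ 2 * E ^ 2 * a * (r ^ β * (r ^ (-γ)) ^ 2) := by ring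
      _ ≤ _ := by
        rw [h2]
        gcongr
  have h2 : (a * r ^ β) ^ (-(2 * σ)) * W ≤ M ^ 2 * E ^ 2 * P ^ 2 * (r ^ (-κ)) ^ 2 := by
    rw [Real.mul_rpow ha0.le (by positivity), ← Real.rpow_mul hr0.le,
      show β * -(2 * σ) = -(2 * κ) by rw [← hβσ]; ring, ← hκ2]
    calc a ^ (-(2 * σ)) * (r ^ (-κ)) ^ 2 * W ≤ P ^ 2 * (r ^ (-κ)) ^ 2 * M ^ 2 := by
          gcongr
          exact hPsq (by linarith)
      _ = M ^ 2 * 1 ^ 2 * P ^ 2 * (r ^ (-κ)) ^ 2 := by ring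
      _ ≤ _ := by gcongr
  calc _ ≤ _ := add_le_add h1 h2
    _ = _ := by rw [hC]; ring
end
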